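/- Let D = (V, A) be a skeletal directed acyclic graph and B ∈ AR(D). For each arc a = (u,v) ∈ B whose reversed arc (v,u) belongs to the transitive reduction of E_B, define B_a = {b ∈ A : there is a directed path in D from u to v containing b such that b is the only arc of that path belonging to B}. Then each B_a belongs to AR(D), B is the join in AR(D) of the B_a over all such arcs a, this join representation is irredundant (no proper subfamily of the B_a has join B), and for every family F ⊆ AR(D) whose join is B and every such arc a there exists F ∈ F with B_a ⊆ F; i.e., {B_a} is the canonical join representation of B. -/

import Mathlib

def ArcRel {V : Type*} (E : Set (V × V)) : V → V → Prop := fun x y => (x, y) ∈ E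

/-- `E` has no directed cycle. -/
def AcyclicArcs {V : Type*} (E : Set (V × V)) : Prop :=
  ∀ v : V, ¬ Relation.TransGen (ArcRel E) v v

/-- `A` is the arc set of a directed acyclic graph: arcs join distinct vertices,
at most one direction between two vertices, and no directed cycle. -/
def IsDAG {V : Type*} (A : Set (V × V)) : Prop :=
  (∀ a ∈ A, a.1 ≠ a.2) ∧ (∀ a ∈ A, Prod.swap a ∉ A) ∧ AcyclicArcs A

/-- Arc set of the reorientation of `A` where exactly the arcs of `B` are reversed. -/
def reorient {V : Type*} (A B : Set (V × V)) : Set (V × V) :=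
  (A \ B) ∪ (Prod.swap '' B)

/-- `B` encodes an acyclic reorientation of `A`. -/
def ARmem {V : Type*} (A B : Set (V × V)) : Prop :=
  B ⊆ A ∧ AcyclicArcs (reorient A B)

/-- The acyclic reorientation poset of `A`, ordered by inclusion of reversed sets. -/
abbrev ARP {V : Type*} (A : Set (V × V)) := {B : Set (V × V) // ARmem A B}

/-- Transitive reduction: delete every arc whose endpoints are joined by a
directed path of length at least 2. -/
def transRed {V : Type*} (E : Set (V × V)) : Set (V × V) :=
  {a ∈ E | ¬ ∃ w : V, ArcRel E a.1 w ∧ Relation.TransGen (ArcRel E) w a.2}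

/-- Underlying undirected graph of an arc set. -/
def undirectedGraph {V : Type*} (E : Set (V × V)) : SimpleGraph V :=
  SimpleGraph.fromRel (fun x y => (x, y) ∈ E)

/-- A directed graph is a forest if its underlying undirected graph has no cycle. -/
def IsForestArcs {V : Type*} (E : Set (V × V)) : Prop :=
  (undirectedGraph E).IsAcyclic

def inducedArcs {V : Type*} (A : Set (V × V)) (U : Set V) : Set (V × V) :=
  {a ∈ A | a.1 ∈ U ∧ a.2 ∈ U}

/-- The transitive reduction of any induced subgraph is a forest. -/
def Vertebrate {V : Type*} (A : Set (V × V)) : Prop :=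
  ∀ U : Set V, IsForestArcs (transRed (inducedArcs A U))

/-- For every directed path from `u` to `v` with `(u,v) ∈ A`, any two vertices of
the path are joined by an arc of `A`. -/
def Filled {V : Type*} (A : Set (V × V)) : Prop :=
  ∀ p : List V, p.Chain' (fun x y => (x, y) ∈ A) →
    ∀ u v : V, p.head? = some u → p.getLast? = some v → (u, v) ∈ A →
      ∀ x ∈ p, ∀ y ∈ p, x ≠ y → ((x, y) ∈ A ∨ (y, x) ∈ A)

def Skeletal {V : Type*} (A : Set (V × V)) : Prop := Vertebrate A ∧ Filled A

/-- The arcs of `B` whose reverse appears in the transitive reduction of `E_B`. -/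
def canArcs {V : Type*} (A B : Set (V × V)) : Set (V × V) :=
  {a | a ∈ B ∧ Prod.swap a ∈ transRed (reorient A B)}

/-- The canonical joinand `B_a` for `a = (u,v)`: arcs `b` of `A` for which there is
a directed path in `A` from `u` to `v` containing `b` such that `b` is the only arc
of that path belonging to `B`. -/
def canJoinand {V : Type*} (A B : Set (V × V)) (u v : V) : Set (V × V) :=
  {b | b ∈ A ∧ ∃ p : List V, p.Chain' (fun x y => (x, y) ∈ A) ∧
    p.head? = some u ∧ p.getLast? = some v ∧ b ∈ p.zip p.tail ∧
    b ∈ B ∧ ∀ c ∈ p.zip p.tail, c ∈ B → c = b}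

/-- `z` is the join (least upper bound) of the family `S` in `AR(A)`. -/
def IsLUBofSet {V : Type*} (A : Set (V × V)) (S : Set (Set (V × V)))
    (z : Set (V × V)) : Prop :=
  ARmem A z ∧ (∀ s ∈ S, s ⊆ z) ∧ ∀ w, ARmem A w → (∀ s ∈ S, s ⊆ w) → z ⊆ w

section Helpers

variable {V : Type*}

theorem tg_mono {R S : V → V → Prop} (h : ∀ x y, R x y → S x y) {a b : V}
    (hab : Relation.TransGen R a b) : Relation.TransGen S a b :=
  Relation.TransGen.lift id h _ _ hab

theorem rtg_mono {R S : V → V → Prop} (h : ∀ x y, R x y → S x y) {a b : V}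
    (hab : Relation.ReflTransGen R a b) : Relation.ReflTransGen S a b :=
  Relation.ReflTransGen.lift id h _ _ hab

theorem mem_reorient_iff {A B : Set (V × V)} {x y : V} :
    (x, y) ∈ reorient A B ↔ ((x, y) ∈ A ∧ (x, y) ∉ B) ∨ (y, x) ∈ B := by
  unfold reorient
  constructor
  · rintro (h | ⟨⟨p, q⟩, h, he⟩)
    · exact Or.inl h
    · simp only [Prod.swap_prod_mk, Prod.mk.injEq] at he
      obtain ⟨rfl, rfl⟩ := he
      exact Or.inr h
  · rintro (h | h)
    · exact Or.inl h
    · exact Or.inr ⟨(y, x), h, rfl⟩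

/-- The triangle condition. -/
def Tri (A B : Set (V × V)) : Prop :=
  ∀ x w y, (x, w) ∈ A → (w, y) ∈ A → (x, y) ∈ A →
    ((x, w) ∈ B → (w, y) ∈ B → (x, y) ∈ B) ∧ ((x, y) ∈ B → (x, w) ∈ B ∨ (w, y) ∈ B)

theorem dag_irr {A : Set (V × V)} (hA : IsDAG A) (x : V) : (x, x) ∉ A :=
  fun h => hA.1 _ h rfl

theorem dag_asymm {A : Set (V × V)} (hA : IsDAG A) {x y : V} (h : (x, y) ∈ A) : (y, x) ∉ A :=
  hA.2.1 _ h

theorem acyc_no3 {E : Set (V × V)} (hE : AcyclicArcs E) {x y z : V} (h1 : (x, y) ∈ E)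
    (h2 : (y, z) ∈ E) (h3 : (z, x) ∈ E) : False :=
  hE x (((Relation.TransGen.single (show ArcRel E x y from h1)).tail h2).tail h3)

theorem tri_of_AR {A B : Set (V × V)} (hB : ARmem A B) : Tri A B := by
  intro x w y h1 h2 h3
  constructor
  · intro b1 b2
    by_contra h
    exact acyc_no3 hB.2 (mem_reorient_iff.2 (Or.inl ⟨h3, h⟩)) (mem_reorient_iff.2 (Or.inr b2))
      (mem_reorient_iff.2 (Or.inr b1))
  · intro b
    by_contra! h
    exact acyc_no3 hB.2 (mem_reorient_iff.2 (Or.inl ⟨h1, h.1⟩))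
      (mem_reorient_iff.2 (Or.inl ⟨h2, h.2⟩)) (mem_reorient_iff.2 (Or.inr b))

theorem exists_rank [Finite V] {E : Set (V × V)} (hE : AcyclicArcs E) :
    ∃ f : V → ℕ, ∀ x y, (x, y) ∈ E → f x < f y := by
  refine ⟨fun y => Set.ncard {z | Relation.TransGen (ArcRel E) z y}, fun x y h => ?_⟩
  apply Set.ncard_lt_ncard _ (Set.toFinite _)
  refine ⟨fun z hz => Relation.TransGen.tail hz h, fun hs => hE x ?_⟩
  exact hs (Relation.TransGen.single h)

theorem list_extend {R : V → V → Prop} {a b : V} (h : Relation.ReflTransGen R a b) {v : V}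
    {q : List V} (hq : q.IsChain R) (hh : q.head? = some b) (hl : q.getLast? = some v) :
    ∃ p : List V, p.IsChain R ∧ p.head? = some a ∧ p.getLast? = some v ∧ ∀ x ∈ q, x ∈ p := by
  induction h using Relation.ReflTransGen.head_induction_on with
  | refl => exact ⟨q, hq, hh, hl, fun _ h => h⟩
  | head hac _ ih =>
    obtain ⟨p, hp, h1, h2, h3⟩ := ih
    cases p with
    | nil => simp at h1
    | cons c p =>
      simp only [List.head?_cons, Option.some.injEq] at h1
      subst h1
      refine ⟨_ :: c :: p, List.isChain_cons_cons.2 ⟨hac, hp⟩, rfl, by simpa using h2, ?_⟩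
      intro x hx
      exact List.mem_cons_of_mem _ (h3 x hx)

theorem filled_pair {A : Set (V × V)} (hA : IsDAG A) (hF : Filled A) {u x y v : V}
    (h1 : Relation.ReflTransGen (ArcRel A) u x) (h2 : Relation.ReflTransGen (ArcRel A) x y)
    (h3 : Relation.ReflTransGen (ArcRel A) y v) (huv : (u, v) ∈ A) : x = y ∨ (x, y) ∈ A := by
  by_cases hxy : x = y
  · exact Or.inl hxy
  right
  obtain ⟨p, hp, a1, a2, a3⟩ := list_extend (R := ArcRel A) h3 (q := [v]) (v := v) (by simp) rfl rfl
  obtain ⟨q, hq, b1, b2, b3⟩ := list_extend h2 hp a1 a2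
  obtain ⟨r, hr, c1, c2, c3⟩ := list_extend h1 hq b1 b2
  have hx : x ∈ r := c3 _ (List.mem_of_head? b1)
  have hy : y ∈ r := c3 _ (b3 _ (List.mem_of_head? a1))
  rcases hF r hr u v c1 c2 huv x hx y hy hxy with h | h
  · exact h
  · exact absurd (Relation.TransGen.tail' h2 h) (hA.2.2 x)

/-- A closed set is one in which every vertex has an out-neighbour. -/
def OutClosed (E : Set (V × V)) (U : Set V) : Prop :=
  U.Nonempty ∧ ∀ z ∈ U, ∃ w ∈ U, (z, w) ∈ E

theorem exists_min_closed [Finite V] {E : Set (V × V)} (h : ¬ AcyclicArcs E) :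
    ∃ U, OutClosed E U ∧ ∀ U' ⊆ U, OutClosed E U' → U' = U := by
  unfold AcyclicArcs at h
  push Not at h
  obtain ⟨v, hv⟩ := h
  have h0 : OutClosed E {z | Relation.TransGen (ArcRel E) z v} := by
    refine ⟨⟨v, hv⟩, fun z hz => ?_⟩
    obtain ⟨c, hc, hcv⟩ := Relation.TransGen.head'_iff.1 hz
    rcases Relation.reflTransGen_iff_eq_or_transGen.1 hcv with rfl | h'
    · exact ⟨_, hv, hc⟩
    · exact ⟨c, h', hc⟩
  obtain ⟨U, hU⟩ := (Set.toFinite {U : Set V | OutClosed E U}).exists_minimal ⟨_, h0⟩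
  exact ⟨U, hU.1, fun U' hs h' => Set.Subset.antisymm hs (hU.2 h' hs)⟩

theorem min_closed_unique [Finite V] {E : Set (V × V)} (hirr : ∀ x, (x, x) ∉ E) {U : Set V}
    (hU : OutClosed E U) (hmin : ∀ U' ⊆ U, OutClosed E U' → U' = U) :
    ∀ x ∈ U, ∀ y ∈ U, ∀ y' ∈ U, (x, y) ∈ E → (x, y') ∈ E → y = y' := by
  have key : ∀ y : U, ∃ z : U, ∀ w ∈ U, (z.1, w) ∈ E → w = y := by
    rintro ⟨y, hy⟩
    by_contra! h
    have hc : OutClosed E (U \ {y}) := by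
      constructor
      · obtain ⟨w, hw, hyw⟩ := hU.2 y hy
        refine ⟨w, hw, ?_⟩
        rintro rfl
        exact hirr _ hyw
      · rintro z ⟨hz, _⟩
        obtain ⟨w, hw, h1, h2⟩ := h ⟨z, hz⟩
        exact ⟨w, ⟨hw, h2⟩, h1⟩
    have := hmin _ Set.sdiff_subset hc
    rw [← this] at hy
    exact hy.2 rfl
  choose p hp using key
  have hinj : Function.Injective p := by
    intro y y' h
    obtain ⟨w, hw, hyw⟩ := hU.2 (p y) (p y).2
    have h1 := hp y w hw hyw
    have h2 := hp y' w hw (h ▸ hyw)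
    exact Subtype.ext (h1.symm.trans h2)
  have hsurj := Finite.surjective_of_injective hinj
  intro x hx y hy y' hy' h h'
  obtain ⟨z, hz⟩ := hsurj ⟨x, hx⟩
  have e : (p z).1 = x := by rw [hz]
  rw [hp z y hy (e ▸ h), hp z y' hy' (e ▸ h')]

theorem undirected_adj {E : Set (V × V)} {x y : V} :
    (undirectedGraph E).Adj x y ↔ x ≠ y ∧ ((x, y) ∈ E ∨ (y, x) ∈ E) := by
  unfold undirectedGraph
  simp [SimpleGraph.fromRel_adj]

theorem AR_of_tri [Finite V] {A B : Set (V × V)} (hA : IsDAG A) (hS : Skeletal A) (hBA : B ⊆ A)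
    (hT : Tri A B) : ARmem A B := by
  refine ⟨hBA, ?_⟩
  by_contra hcyc
  obtain ⟨U, hU, hmin⟩ := exists_min_closed hcyc
  have hEA : ∀ x y, (x, y) ∈ reorient A B → (x, y) ∈ A ∨ (y, x) ∈ A := by
    intro x y h
    rcases mem_reorient_iff.1 h with h | h
    · exact Or.inl h.1
    · exact Or.inr (hBA h)
  have hAE : ∀ x y, (x, y) ∈ A → (x, y) ∈ reorient A B ∨ (y, x) ∈ reorient A B := by
    intro x y h
    by_cases hb : (x, y) ∈ B
    · exact Or.inr (mem_reorient_iff.2 (Or.inr hb))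
    · exact Or.inl (mem_reorient_iff.2 (Or.inl ⟨h, hb⟩))
  have hirr : ∀ x, (x, x) ∉ reorient A B := by
    intro x h
    rcases hEA _ _ h with h | h <;> exact dag_irr hA _ h
  have hasym : ∀ x y, (x, y) ∈ reorient A B → (y, x) ∉ reorient A B := by
    intro x y h h'
    rcases mem_reorient_iff.1 h with ⟨h1, h2⟩ | h1 <;>
      rcases mem_reorient_iff.1 h' with ⟨h3, h4⟩ | h3
    · exact dag_asymm hA h1 h3
    · exact h2 h3
    · exact h4 h1
    · exact dag_asymm hA (hBA h1) (hBA h3)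
  have huniq := min_closed_unique hirr hU hmin
  -- no transitive triangles of `A` inside `U`
  have hno : ∀ x ∈ U, ∀ w ∈ U, ∀ y ∈ U, (x, w) ∈ A → (w, y) ∈ A → (x, y) ∈ A → False := by
    intro x hx w hw y hy h1 h2 h3
    have t := hT x w y h1 h2 h3
    have n1 : x ≠ w := by rintro rfl; exact dag_irr hA _ h1
    have n2 : w ≠ y := by rintro rfl; exact dag_irr hA _ h2
    have n3 : x ≠ y := by rintro rfl; exact dag_irr hA _ h3
    have i1 : ∀ {p q}, (p, q) ∈ A → (p, q) ∉ B → (p, q) ∈ reorient A B :=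
      fun h h' => mem_reorient_iff.2 (Or.inl ⟨h, h'⟩)
    have i2 : ∀ {p q}, (p, q) ∈ B → (q, p) ∈ reorient A B :=
      fun h => mem_reorient_iff.2 (Or.inr h)
    by_cases b1 : (x, w) ∈ B
    · by_cases b2 : (w, y) ∈ B
      · exact n1 (huniq y hy x hx w hw (i2 (t.1 b1 b2)) (i2 b2))
      · exact n3 (huniq w hw x hx y hy (i2 b1) (i1 h2 b2))
    · by_cases b2 : (w, y) ∈ B
      · by_cases b3 : (x, y) ∈ B
        · exact n1 (huniq y hy x hx w hw (i2 b3) (i2 b2))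
        · exact n2 (huniq x hx w hw y hy (i1 h1 b1) (i1 h3 b3))
      · by_cases b3 : (x, y) ∈ B
        · rcases t.2 b3 with h | h
          · exact b1 h
          · exact b2 h
        · exact n2 (huniq x hx w hw y hy (i1 h1 b1) (i1 h3 b3))
  have hind : ∀ x y, (x, y) ∈ inducedArcs A U → (x, y) ∈ transRed (inducedArcs A U) := by
    intro x y h
    refine ⟨h, ?_⟩
    rintro ⟨w, hxw, hwy⟩
    have hwy' : Relation.ReflTransGen (ArcRel A) w y :=
      Relation.TransGen.to_reflTransGen (tg_mono (fun _ _ h => h.1) hwy)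
    have hxw' : (x, w) ∈ A := hxw.1
    rcases filled_pair hA hS.2 (Relation.ReflTransGen.single hxw') hwy'
      Relation.ReflTransGen.refl h.1 with e | e
    · subst e
      exact hA.2.2 w (tg_mono (fun _ _ h => h.1) hwy)
    · exact hno x h.2.1 w hxw.2.2 y h.2.2 hxw' e h.1
  have hac := hS.1 U
  unfold IsForestArcs at hac
  set G := undirectedGraph (transRed (inducedArcs A U)) with hG
  have hadj : ∀ x ∈ U, ∀ y ∈ U, (x, y) ∈ reorient A B → G.Adj x y := by
    intro x hx y hy h
    rw [hG, undirected_adj]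
    refine ⟨?_, ?_⟩
    · rintro rfl
      exact hirr _ h
    · rcases hEA _ _ h with h | h
      · exact Or.inl (hind _ _ ⟨h, hx, hy⟩)
      · exact Or.inr (hind _ _ ⟨h, hy, hx⟩)
  obtain ⟨x, hx⟩ := hU.1
  obtain ⟨y, hy, hxy⟩ := hU.2 x hx
  have hbr := SimpleGraph.isAcyclic_iff_forall_adj_isBridge.1 hac (hadj x hx y hy hxy)
  rw [SimpleGraph.isBridge_iff] at hbr
  apply hbr
  rw [SimpleGraph.reachable_comm]
  by_contra hnr
  have hc : OutClosed (reorient A B)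
      {z | z ∈ U ∧ (G.deleteEdges {s(x, y)}).Reachable y z} := by
    refine ⟨⟨y, hy, SimpleGraph.Reachable.refl _⟩, ?_⟩
    rintro z ⟨hz, hr⟩
    have hzx : z ≠ x := by
      rintro rfl
      exact hnr hr
    obtain ⟨w, hw, hzw⟩ := hU.2 z hz
    refine ⟨w, ⟨hw, hr.trans (SimpleGraph.Adj.reachable ?_)⟩, hzw⟩
    rw [SimpleGraph.deleteEdges_adj]
    refine ⟨hadj z hz w hw hzw, ?_⟩
    simp only [Set.mem_singleton_iff, Sym2.eq_iff]
    rintro (⟨e, _⟩ | ⟨rfl, rfl⟩)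
    · exact hzx e
    · exact hasym _ _ hzw hxy
  have := hmin _ (fun z hz => hz.1) hc
  rw [← this] at hx
  exact hnr hx.2

/-- The intervals of a vertebrate graph are chains. -/
theorem interval_chain {A : Set (V × V)} (hA : IsDAG A) (hV : Vertebrate A) {u v w x : V}
    (huv : (u, v) ∈ A)
    (h1 : (u, w) ∈ A) (h2 : (w, v) ∈ A) (h3 : (u, x) ∈ A) (h4 : (x, v) ∈ A) :
    w = x ∨ (w, x) ∈ A ∨ (x, w) ∈ A := by
  by_contra! hcon
  obtain ⟨hne, hwx, hxw⟩ := hcon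
  have hU : ∀ w x : V, (w, x) ∉ A → (x, w) ∉ A → (u, w) ∈ A → (w, v) ∈ A → ∀ U : Set V,
      U = {u, w, x, v} → (u, w) ∈ transRed (inducedArcs A U) ∧
        (w, v) ∈ transRed (inducedArcs A U) := by
    rintro w x hwx hxw h1 h2 U rfl
    constructor
    · refine ⟨⟨h1, by simp, by simp⟩, ?_⟩
      rintro ⟨z, hz, ht⟩
      obtain ⟨c, hc, hcw⟩ := Relation.TransGen.tail'_iff.1 ht
      have hcu : c = u := by
        have hcU : c ∈ ({u, w, x, v} : Set V) := hcw.2.1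
        have hcA : (c, w) ∈ A := hcw.1
        rcases hcU with h | h | h | h
        · exact h
        · subst h; exact absurd hcA (dag_irr hA _)
        · subst h; exact absurd hcA hxw
        · rw [Set.mem_singleton_iff] at h
          subst h; exact absurd hcA (dag_asymm hA h2)
      subst hcu
      have hc' : Relation.ReflTransGen (ArcRel A) z c :=
        rtg_mono (fun _ _ h => h.1) hc
      exact hA.2.2 c (Relation.TransGen.head' hz.1 hc')
    · refine ⟨⟨h2, by simp, by simp⟩, ?_⟩
      rintro ⟨z, hz, ht⟩
      have hzv : z = v := by
        have hcU : z ∈ ({u, w, x, v} : Set V) := hz.2.2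
        have hcA : (w, z) ∈ A := hz.1
        rcases hcU with h | h | h | h
        · subst h; exact absurd hcA (dag_asymm hA h1)
        · subst h; exact absurd hcA (dag_irr hA _)
        · subst h; exact absurd hcA hwx
        · exact h
      subst hzv
      exact hA.2.2 z (tg_mono (fun _ _ h => h.1) ht)
  have a1 := hU w x hwx hxw h1 h2 {u, w, x, v} rfl
  have a2 := hU x w hxw hwx h3 h4 {u, w, x, v} (by ext; simp; tauto)
  have hac := hV {u, w, x, v}
  unfold IsForestArcs at hac
  have d1 : u ≠ w := by rintro rfl; exact dag_irr hA _ h1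
  have d2 : w ≠ v := by rintro rfl; exact dag_irr hA _ h2
  have d3 : u ≠ x := by rintro rfl; exact dag_irr hA _ h3
  have d4 : x ≠ v := by rintro rfl; exact dag_irr hA _ h4
  have d5 : u ≠ v := by rintro rfl; exact dag_irr hA _ huv
  have hbr := SimpleGraph.isAcyclic_iff_forall_adj_isBridge.1 hac
    (undirected_adj.2 ⟨d1, Or.inl a1.1⟩)
  rw [SimpleGraph.isBridge_iff] at hbr
  apply hbr
  have r1 : ((undirectedGraph (transRed (inducedArcs A {u, w, x, v}))).deleteEdges
      {s(u, w)}).Adj u x := by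
    rw [SimpleGraph.deleteEdges_adj, undirected_adj]
    refine ⟨⟨d3, Or.inl a2.1⟩, ?_⟩
    simp only [Set.mem_singleton_iff, Sym2.eq_iff]
    grind
  have r2 : ((undirectedGraph (transRed (inducedArcs A {u, w, x, v}))).deleteEdges
      {s(u, w)}).Adj x v := by
    rw [SimpleGraph.deleteEdges_adj, undirected_adj]
    refine ⟨⟨d4, Or.inl a2.2⟩, ?_⟩
    simp only [Set.mem_singleton_iff, Sym2.eq_iff]
    grind
  have r3 : ((undirectedGraph (transRed (inducedArcs A {u, w, x, v}))).deleteEdges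
      {s(u, w)}).Adj v w := by
    rw [SimpleGraph.deleteEdges_adj, undirected_adj]
    refine ⟨⟨d2.symm, Or.inr a1.2⟩, ?_⟩
    simp only [Set.mem_singleton_iff, Sym2.eq_iff]
    grind
  exact (r1.reachable.trans r2.reachable).trans r3.reachable

theorem AR_erase [Finite V] {A B : Set (V × V)} (hA : IsDAG A) (hS : Skeletal A)
    (hB : ARmem A B) {x y : V}
    (hno : ¬ ∃ w, (y, w) ∈ reorient A B ∧ (w, x) ∈ reorient A B) : ARmem A (B \ {(x, y)}) := by
  have t := tri_of_AR hB
  have i1 : ∀ {p q}, (p, q) ∈ A → (p, q) ∉ B → (p, q) ∈ reorient A B :=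
    fun h h' => mem_reorient_iff.2 (Or.inl ⟨h, h'⟩)
  have i2 : ∀ {p q}, (p, q) ∈ B → (q, p) ∈ reorient A B :=
    fun h => mem_reorient_iff.2 (Or.inr h)
  refine AR_of_tri hA hS (fun b hb => hB.1 hb.1) ?_
  intro p q r h1 h2 h3
  have n1 : p ≠ q := by rintro rfl; exact dag_irr hA _ h1
  have n2 : q ≠ r := by rintro rfl; exact dag_irr hA _ h2
  have tt := t p q r h1 h2 h3
  constructor
  · rintro ⟨b1, _⟩ ⟨b2, _⟩
    refine ⟨tt.1 b1 b2, ?_⟩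
    intro e
    simp only [Set.mem_singleton_iff, Prod.mk.injEq] at e
    obtain ⟨rfl, rfl⟩ := e
    exact hno ⟨q, i2 b2, i2 b1⟩
  · rintro ⟨b3, b4⟩
    by_cases b1 : (p, q) ∈ B
    · by_cases e : p = x ∧ q = y
      · obtain ⟨rfl, rfl⟩ := e
        by_cases b2 : (q, r) ∈ B
        · refine Or.inr ⟨b2, ?_⟩
          simp only [Set.mem_singleton_iff, Prod.mk.injEq]
          exact fun h => n1 h.1.symm
        · exact absurd ⟨r, i1 h2 b2, i2 b3⟩ hno
      · refine Or.inl ⟨b1, ?_⟩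
        simpa only [Set.mem_singleton_iff, Prod.mk.injEq] using e
    · have b2 := (tt.2 b3).resolve_left b1
      by_cases e : q = x ∧ r = y
      · obtain ⟨rfl, rfl⟩ := e
        exact absurd ⟨p, i2 b3, i1 h1 b1⟩ hno
      · refine Or.inr ⟨b2, ?_⟩
        simpa only [Set.mem_singleton_iff, Prod.mk.injEq] using e

theorem exists_mid [Finite V] {A B : Set (V × V)} (hA : IsDAG A) (hS : Skeletal A)
    (hB : ARmem A B) {x y : V} (hxy : (x, y) ∈ B)
    (hn : (y, x) ∉ transRed (reorient A B)) :
    ∃ w, (y, w) ∈ reorient A B ∧ (w, x) ∈ reorient A B := by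
  by_contra hno
  have hB' := AR_erase hA hS hB hno
  have hyx : (y, x) ∈ reorient A B := mem_reorient_iff.2 (Or.inr hxy)
  have hmap : ∀ p q, (p, q) ∈ reorient A B → (p = y ∧ q = x) ∨
      (p, q) ∈ reorient A (B \ {(x, y)}) := by
    intro p q h
    by_cases e : p = y ∧ q = x
    · exact Or.inl e
    right
    rcases mem_reorient_iff.1 h with h | h
    · exact mem_reorient_iff.2 (Or.inl ⟨h.1, fun h' => h.2 h'.1⟩)
    · refine mem_reorient_iff.2 (Or.inr ⟨h, ?_⟩)
      simp only [Set.mem_singleton_iff, Prod.mk.injEq]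
      exact fun h' => e ⟨h'.2, h'.1⟩
  apply hn
  refine ⟨hyx, ?_⟩
  rintro ⟨w, hyw0, hwx0⟩
  have hyw : (y, w) ∈ reorient A B := hyw0
  have hwx : Relation.TransGen (ArcRel (reorient A B)) w x := hwx0
  have claim : Relation.TransGen (ArcRel (reorient A (B \ {(x, y)}))) w x ∨
      Relation.ReflTransGen (ArcRel (reorient A B)) w y := by
    clear hyw hyw0 hwx0
    induction hwx using Relation.TransGen.head_induction_on with
    | @single p h =>
      rcases hmap _ _ h with e | e
      · rw [e.1]; exact Or.inr Relation.ReflTransGen.refl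
      · exact Or.inl (Relation.TransGen.single e)
    | @head p q h _ ih =>
      rcases hmap _ _ h with e | e
      · rw [e.1]; exact Or.inr Relation.ReflTransGen.refl
      · rcases ih with ih | ih
        · exact Or.inl (Relation.TransGen.head e ih)
        · exact Or.inr (Relation.ReflTransGen.head h ih)
  rcases claim with h | h
  · rcases hmap _ _ hyw with ⟨_, e⟩ | e
    · subst e
      exact hB'.2 _ h
    · have hxy' : (x, y) ∈ reorient A (B \ {(x, y)}) :=
        mem_reorient_iff.2 (Or.inl ⟨hB.1 hxy, fun h' => h'.2 rfl⟩)
      exact hB'.2 y ((Relation.TransGen.head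
        (show ArcRel (reorient A (B \ {(x, y)})) y w from e) h).tail hxy')
  · exact hB.2 y (Relation.TransGen.head' hyw h)

/-- Splitting of a path at an arc. -/
theorem path_split {R : V → V → Prop} {u v x y : V} (p : List V) (hp : p.IsChain R)
    (hh : p.head? = some u) (hl : p.getLast? = some v) (hb : (x, y) ∈ p.zip p.tail)
    {Q : V × V → Prop} (hQ : ∀ c ∈ p.zip p.tail, Q c) :
    Relation.ReflTransGen (fun s t => R s t ∧ Q (s, t)) u x ∧
    Relation.ReflTransGen (fun s t => R s t ∧ Q (s, t)) y v := by
  have aux : ∀ (p : List V) (u : V), p.IsChain R → p.head? = some u → p.getLast? = some v →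
      (∀ c ∈ p.zip p.tail, Q c) →
      Relation.ReflTransGen (fun s t => R s t ∧ Q (s, t)) u v := by
    intro p
    induction p with
    | nil => intro u _ h; simp at h
    | cons a p ih =>
      intro u hp hh hl hQ
      simp only [List.head?_cons, Option.some.injEq] at hh
      subst hh
      cases p with
      | nil =>
        simp only [List.getLast?_singleton, Option.some.injEq] at hl
        subst hl
        exact Relation.ReflTransGen.refl
      | cons c p =>
        rw [List.isChain_cons_cons] at hp
        refine Relation.ReflTransGen.head ⟨hp.1, hQ _ (by simp)⟩
          (ih c hp.2 rfl (by simpa using hl) ?_)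
        intro d hd
        apply hQ
        simp only [List.tail_cons, List.zip_cons_cons, List.mem_cons] at hd ⊢
        exact Or.inr hd
  induction p generalizing u with
  | nil => simp at hh
  | cons a p ih =>
    simp only [List.head?_cons, Option.some.injEq] at hh
    subst hh
    cases p with
    | nil => simp at hb
    | cons c p =>
      rw [List.isChain_cons_cons] at hp
      have hQ' : ∀ d ∈ (c :: p).zip (c :: p).tail, Q d := by
        intro d hd
        apply hQ
        simp only [List.tail_cons, List.zip_cons_cons, List.mem_cons] at hd ⊢
        exact Or.inr hd
      have hl' : (c :: p).getLast? = some v := by simpa using hl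
      have hb' : (x, y) = (a, c) ∨ (x, y) ∈ (c :: p).zip (c :: p).tail := by
        simp only [List.tail_cons, List.zip_cons_cons, List.mem_cons] at hb ⊢
        exact hb
      rcases hb' with e | e
      · simp only [Prod.mk.injEq] at e
        obtain ⟨rfl, rfl⟩ := e
        exact ⟨Relation.ReflTransGen.refl, aux _ _ hp.2 rfl hl' hQ'⟩
      · have := ih hp.2 rfl hl' e hQ'
        exact ⟨Relation.ReflTransGen.head ⟨hp.1, hQ _ (by simp)⟩ this.1, this.2⟩

/-- Simple description of the canonical joinand. -/
def KJ (A B : Set (V × V)) (u v x y : V) : Prop :=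
  (x, y) ∈ A ∧ (x, y) ∈ B ∧ (u = x ∨ ((u, x) ∈ A ∧ (u, x) ∉ B)) ∧
    (y = v ∨ ((y, v) ∈ A ∧ (y, v) ∉ B))

theorem not_mem_of_path {A B : Set (V × V)} (hB : ARmem A B) {u x : V}
    (h : Relation.ReflTransGen (fun s t => (s, t) ∈ A ∧ (s, t) ∉ B) u x) : (u, x) ∉ B := by
  intro hb
  have h' : Relation.ReflTransGen (ArcRel (reorient A B)) u x :=
    rtg_mono (fun s t h => mem_reorient_iff.2 (Or.inl h)) h
  exact hB.2 x (Relation.TransGen.head' (show ArcRel (reorient A B) x u from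
    mem_reorient_iff.2 (Or.inr hb)) h')

theorem canJoinand_iff {A B : Set (V × V)} (hA : IsDAG A) (hF : Filled A) (hB : ARmem A B)
    {u v : V} (huv : (u, v) ∈ A) (x y : V) :
    (x, y) ∈ canJoinand A B u v ↔ KJ A B u v x y := by
  constructor
  · rintro ⟨hxy, p, hp, hh, hl, hb, hbB, hun⟩
    obtain ⟨h1, h2⟩ := path_split (Q := fun c => c ∈ B → c = (x, y)) p hp hh hl hb hun
    have g1 : Relation.ReflTransGen (fun s t => (s, t) ∈ A ∧ (s, t) ∉ B) u x := by
      clear hh huv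
      induction h1 using Relation.ReflTransGen.head_induction_on with
      | refl => exact Relation.ReflTransGen.refl
      | @head s t hst htx ih =>
        refine Relation.ReflTransGen.head ⟨hst.1, fun hbb => ?_⟩ ih
        have e := hst.2 hbb
        simp only [Prod.mk.injEq] at e
        obtain ⟨rfl, rfl⟩ := e
        have htx' : Relation.ReflTransGen (ArcRel A) t s := rtg_mono (fun _ _ h => h.1) htx
        exact hA.2.2 t (Relation.TransGen.tail' htx' hxy)
    have g2 : Relation.ReflTransGen (fun s t => (s, t) ∈ A ∧ (s, t) ∉ B) y v := by
      clear hl huv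
      induction h2 with
      | refl => exact Relation.ReflTransGen.refl
      | @tail s t hys hst ih =>
        refine Relation.ReflTransGen.tail ih ⟨hst.1, fun hbb => ?_⟩
        have e := hst.2 hbb
        simp only [Prod.mk.injEq] at e
        obtain ⟨rfl, rfl⟩ := e
        have hys' : Relation.ReflTransGen (ArcRel A) t s := rtg_mono (fun _ _ h => h.1) hys
        exact hA.2.2 t (Relation.TransGen.tail' hys' hxy)
    have k1 : Relation.ReflTransGen (ArcRel A) u x := rtg_mono (fun _ _ h => h.1) g1
    have k2 : Relation.ReflTransGen (ArcRel A) y v := rtg_mono (fun _ _ h => h.1) g2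
    have kxy : Relation.ReflTransGen (ArcRel A) x y := Relation.ReflTransGen.single hxy
    refine ⟨hxy, hbB, ?_, ?_⟩
    · rcases filled_pair hA hF Relation.ReflTransGen.refl k1 (kxy.trans k2) huv with h | h
      · exact Or.inl h
      · exact Or.inr ⟨h, not_mem_of_path hB g1⟩
    · rcases filled_pair hA hF (k1.trans kxy) k2 Relation.ReflTransGen.refl huv with h | h
      · exact Or.inl h
      · exact Or.inr ⟨h, not_mem_of_path hB g2⟩
  · rintro ⟨hxy, hb, h1, h2⟩
    refine ⟨hxy, ?_⟩
    rcases h1 with rfl | ⟨h1, h1'⟩ <;> rcases h2 with rfl | ⟨h2, h2'⟩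
    · exact ⟨[u, y], by simpa [List.Chain'] using hxy, rfl, rfl, by simp, hb, by simp⟩
    · refine ⟨[u, y, v], by simpa [List.Chain'] using ⟨hxy, h2⟩, rfl, rfl, by simp, hb, ?_⟩
      intro c hc hcB
      simp at hc
      grind
    · refine ⟨[u, x, y], by simpa [List.Chain'] using ⟨h1, hxy⟩, rfl, rfl, by simp, hb, ?_⟩
      intro c hc hcB
      simp at hc
      grind
    · refine ⟨[u, x, y, v], by simpa [List.Chain'] using ⟨h1, hxy, h2⟩, rfl, rfl, by simp, hb, ?_⟩
      intro c hc hcB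
      simp at hc
      grind

/-- Facts on a canonical arc. -/
theorem can_no_mid {A B : Set (V × V)} {u v : V} (ha : (u, v) ∈ canArcs A B) {w : V}
    (h1 : (v, w) ∈ reorient A B) (h2 : (w, u) ∈ reorient A B) : False :=
  ha.2.2 ⟨w, h1, Relation.TransGen.single h2⟩

theorem can_AR [Finite V] {A B : Set (V × V)} (hA : IsDAG A) (hS : Skeletal A)
    (hB : ARmem A B) {u v : V} (ha : (u, v) ∈ canArcs A B) :
    ARmem A (canJoinand A B u v) := by
  have hauB : (u, v) ∈ B := ha.1
  have huv : (u, v) ∈ A := hB.1 hauB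
  have t := tri_of_AR hB
  have i1 : ∀ {p q}, (p, q) ∈ A → (p, q) ∉ B → (p, q) ∈ reorient A B :=
    fun h h' => mem_reorient_iff.2 (Or.inl ⟨h, h'⟩)
  have i2 : ∀ {p q}, (p, q) ∈ B → (q, p) ∈ reorient A B :=
    fun h => mem_reorient_iff.2 (Or.inr h)
  have rt : ∀ {p q}, (p = q ∨ ((p, q) ∈ A ∧ (p, q) ∉ B)) →
      Relation.ReflTransGen (ArcRel A) p q := by
    rintro p q (rfl | h)
    · exact Relation.ReflTransGen.refl
    · exact Relation.ReflTransGen.single h.1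
  refine AR_of_tri hA hS (fun b hb => hb.1) ?_
  intro x w y h1 h2 h3
  simp only [canJoinand_iff hA hS.2 hB huv]
  constructor
  · rintro ⟨_, b1, l1, r1⟩ ⟨_, b2, l2, r2⟩
    exfalso
    rcases l2 with rfl | l2
    · rcases r1 with rfl | r1
      · exact dag_irr hA _ huv
      · exact r1.2 hauB
    · rcases r1 with rfl | r1
      · exact l2.2 hauB
      · rcases (t u w v l2.1 r1.1 huv).2 hauB with h | h
        · exact l2.2 h
        · exact r1.2 h
  · rintro ⟨_, b3, l, r⟩
    have k1 : Relation.ReflTransGen (ArcRel A) u w := (rt l).tail h1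
    have k2 : Relation.ReflTransGen (ArcRel A) w v := Relation.ReflTransGen.head h2 (rt r)
    have huw : (u, w) ∈ A := by
      rcases filled_pair hA hS.2 Relation.ReflTransGen.refl k1 k2 huv with h | h
      · subst h
        exact absurd (Relation.TransGen.tail' (rt l) h1) (hA.2.2 u)
      · exact h
    have hwv : (w, v) ∈ A := by
      rcases filled_pair hA hS.2 k1 k2 Relation.ReflTransGen.refl huv with h | h
      · subst h
        exact absurd (Relation.TransGen.head' h2 (rt r)) (hA.2.2 w)
      · exact h
    by_cases c1 : (u, w) ∈ B
    · have c2 : (w, v) ∉ B := fun c2 => can_no_mid ha (i2 c2) (i2 c1)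
      left
      refine ⟨h1, ?_, l, Or.inr ⟨hwv, c2⟩⟩
      rcases l with rfl | l
      · exact c1
      · by_contra hn
        rcases (t u x w l.1 h1 huw).2 c1 with h | h
        · exact l.2 h
        · exact hn h
    · right
      have c2 : (w, v) ∈ B := ((t u w v huw hwv huv).2 hauB).resolve_left c1
      refine ⟨h2, ?_, Or.inr ⟨huw, c1⟩, r⟩
      rcases r with rfl | r
      · exact c2
      · by_contra hn
        rcases (t w y v h2 r.1 hwv).2 c2 with h | h
        · exact hn h
        · exact r.2 h

/-- Any acyclic reorientation containing all the joinands contains `B`. -/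
theorem can_least [Finite V] {A B W : Set (V × V)} (hA : IsDAG A) (hS : Skeletal A)
    (hB : ARmem A B) (hW : ARmem A W)
    (hs : ∀ u v, (u, v) ∈ canArcs A B → canJoinand A B u v ⊆ W) : B ⊆ W := by
  obtain ⟨f, hf⟩ := exists_rank hA.2.2
  obtain ⟨g, hg⟩ := exists_rank hB.2
  have t := tri_of_AR hB
  have tW := tri_of_AR hW
  have i1 : ∀ {p q}, (p, q) ∈ A → (p, q) ∉ B → (p, q) ∈ reorient A B :=
    fun h h' => mem_reorient_iff.2 (Or.inl ⟨h, h'⟩)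
  have i2 : ∀ {p q}, (p, q) ∈ B → (q, p) ∈ reorient A B :=
    fun h => mem_reorient_iff.2 (Or.inr h)
  have hfill : ∀ {a b c d}, (a, b) ∈ A → Relation.ReflTransGen (ArcRel A) b c →
      Relation.ReflTransGen (ArcRel A) c d → (a, d) ∈ A → (a, c) ∈ A := by
    intro a b c d h1 h2 h3 h4
    rcases filled_pair hA hS.2 Relation.ReflTransGen.refl
      (Relation.ReflTransGen.head h1 h2) h3 h4 with h | h
    · subst h
      exact absurd (Relation.TransGen.head' h1 h2) (hA.2.2 a)
    · exact h
  have hfill' : ∀ {a b c d}, (c, d) ∈ A → Relation.ReflTransGen (ArcRel A) b c →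
      Relation.ReflTransGen (ArcRel A) a b → (a, d) ∈ A → (b, d) ∈ A := by
    intro a b c d h1 h2 h3 h4
    rcases filled_pair hA hS.2 h3 (Relation.ReflTransGen.tail h2 h1)
      Relation.ReflTransGen.refl h4 with h | h
    · subst h
      exact absurd (Relation.TransGen.tail' h2 h1) (hA.2.2 b)
    · exact h
  have rt : ∀ {p q}, (p = q ∨ ((p, q) ∈ A ∧ (p, q) ∉ B)) →
      Relation.ReflTransGen (ArcRel A) p q := by
    rintro p q (rfl | h)
    · exact Relation.ReflTransGen.refl
    · exact Relation.ReflTransGen.single h.1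
  have outer : ∀ n x y, f y - f x < n → (x, y) ∈ B → (x, y) ∈ W := by
    intro n
    induction n with
    | zero => intro x y h; omega
    | succ n ihn =>
      intro x y hn hxy
      have hxyA := hB.1 hxy
      have inner : ∀ m u v, g u - g v < m → (u, v) ∈ B → KJ A B u v x y → (x, y) ∈ W := by
        intro m
        induction m with
        | zero => intro u v h; omega
        | succ m ihm =>
          intro u v hm huvB hK
          have huv := hB.1 huvB
          obtain ⟨-, -, l, r⟩ := hK
          have hgvu := hg _ _ (i2 huvB)
          have rl := rt l
          have rr := rt r
          have rxy : Relation.ReflTransGen (ArcRel A) x y := Relation.ReflTransGen.single hxyA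
          by_cases hcan : (v, u) ∈ transRed (reorient A B)
          · exact hs u v ⟨huvB, hcan⟩
              ((canJoinand_iff hA hS.2 hB huv x y).2 ⟨hxyA, hxy, l, r⟩)
          obtain ⟨w, hvw, hwu⟩ := exists_mid hA hS hB huvB hcan
          have g1 := hg _ _ hvw
          have g2 := hg _ _ hwu
          rcases mem_reorient_iff.1 hwu with ⟨wuA, wuB⟩ | uwB
          · -- `w → u` unreversed
            have wvB : (w, v) ∈ B := by
              rcases mem_reorient_iff.1 hvw with ⟨vwA, _⟩ | h
              · exact (acyc_no3 hA.2.2 wuA huv vwA).elim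
              · exact h
            refine ihm w v (by omega) wvB ⟨hxyA, hxy, Or.inr ?_, r⟩
            have hwx : (w, x) ∈ A := hfill wuA rl (rxy.trans rr) (hB.1 wvB)
            refine ⟨hwx, ?_⟩
            rcases l with rfl | l
            · exact wuB
            · intro hb
              rcases (t w u x wuA l.1 hwx).2 hb with h | h
              · exact wuB h
              · exact l.2 h
          · have uwA := hB.1 uwB
            rcases mem_reorient_iff.1 hvw with ⟨vwA, vwB⟩ | wvB
            · -- `v → w` unreversed
              refine ihm u w (by omega) uwB ⟨hxyA, hxy, l, Or.inr ?_⟩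
              have hyw : (y, w) ∈ A := hfill' vwA rr (rl.trans rxy) uwA
              refine ⟨hyw, ?_⟩
              rcases r with rfl | r
              · exact vwB
              · intro hb
                rcases (t y v w r.1 vwA hyw).2 hb with h | h
                · exact r.2 h
                · exact vwB h
            · have wvA := hB.1 wvB
              -- position of `w` with respect to `x`
              have cx : (w, x) ∈ A ∨ (x, w) ∈ A := by
                rcases l with rfl | l
                · exact Or.inr uwA
                · have hxv : (x, v) ∈ A := by
                    rcases r with rfl | r
                    · exact hxyA
                    · exact hfill' r.1 rxy rl huv
                  rcases interval_chain hA hS.1 huv uwA wvA l.1 hxv with h | h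
                  · subst h; exact absurd uwB l.2
                  · exact h
              have cy : (w, y) ∈ A ∨ (y, w) ∈ A := by
                rcases r with rfl | r
                · exact Or.inl wvA
                · have huy : (u, y) ∈ A := by
                    rcases l with rfl | l
                    · exact hxyA
                    · exact hfill l.1 rxy rr huv
                  rcases interval_chain hA hS.1 huv uwA wvA huy r.1 with h | h
                  · subst h; exact absurd wvB r.2
                  · exact h
              rcases cx with hwx | hxw
              · refine ihm w v (by omega) wvB ⟨hxyA, hxy, Or.inr ⟨hwx, ?_⟩, r⟩
                intro hb
                rcases l with rfl | l
                · exact dag_asymm hA uwA hwx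
                · exact l.2 ((t u w x uwA hwx l.1).1 uwB hb)
              · rcases cy with hwy | hyw
                · have xwB : (x, w) ∈ B := by
                    rcases l with rfl | l
                    · exact uwB
                    · exact ((t u x w l.1 hxw uwA).2 uwB).resolve_left l.2
                  have wyB : (w, y) ∈ B := by
                    rcases r with rfl | r
                    · exact wvB
                    · exact ((t w y v hwy r.1 wvA).2 wvB).resolve_right r.2
                  have f1 := hf _ _ hxw
                  have f2 := hf _ _ hwy
                  exact (tW x w y hxw hwy hxyA).1 (ihn x w (by omega) xwB)
                    (ihn w y (by omega) wyB)
                · refine ihm u w (by omega) uwB ⟨hxyA, hxy, l, Or.inr ⟨hyw, ?_⟩⟩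
                  intro hb
                  rcases r with rfl | r
                  · exact dag_asymm hA wvA hyw
                  · exact r.2 ((t y w v hyw wvA r.1).1 hb wvB)
      exact inner _ x y (Nat.lt_succ_self _) hxy ⟨hxyA, hxy, Or.inl rfl, Or.inl rfl⟩
  rintro ⟨x, y⟩ hb
  exact outer _ x y (Nat.lt_succ_self _) hb

theorem can_refine [Finite V] {A B : Set (V × V)} (hA : IsDAG A) (hS : Skeletal A)
    (hB : ARmem A B) (F : Set (Set (V × V))) (hF : ∀ f ∈ F, ARmem A f)
    (hl : IsLUBofSet A F B) {u v : V} (ha : (u, v) ∈ canArcs A B) :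
    ∃ f ∈ F, canJoinand A B u v ⊆ f := by
  have hauB : (u, v) ∈ B := ha.1
  have huv : (u, v) ∈ A := hB.1 hauB
  have hE : ARmem A (B \ {(u, v)}) :=
    AR_erase hA hS hB (fun ⟨w, h1, h2⟩ => can_no_mid ha h1 h2)
  have hex : ∃ f ∈ F, (u, v) ∈ f := by
    by_contra! h
    have := hl.2.2 _ hE (fun f hf b hb => ⟨hl.2.1 f hf hb, by
      rintro rfl
      exact h f hf hb⟩)
    exact (this hauB).2 rfl
  obtain ⟨f, hf, huf⟩ := hex
  refine ⟨f, hf, ?_⟩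
  have t := tri_of_AR (hF f hf)
  have hfB := hl.2.1 f hf
  rintro ⟨x, y⟩ hxy
  obtain ⟨hxyA, hxyB, l, r⟩ := (canJoinand_iff hA hS.2 hB huv x y).1 hxy
  have rr : Relation.ReflTransGen (ArcRel A) y v := by
    rcases r with rfl | r
    · exact Relation.ReflTransGen.refl
    · exact Relation.ReflTransGen.single r.1
  have hxvA : (x, v) ∈ A := by
    rcases l with rfl | l
    · exact huv
    · rcases filled_pair hA hS.2 (Relation.ReflTransGen.single (show ArcRel A u x from l.1))
        (Relation.ReflTransGen.head (show ArcRel A x y from hxyA) rr)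
        Relation.ReflTransGen.refl huv with h | h
      · subst h
        exact absurd hauB l.2
      · exact h
  have hxv : (x, v) ∈ f := by
    rcases l with rfl | l
    · exact huf
    · exact ((t u x v l.1 hxvA huv).2 huf).resolve_left (fun h => l.2 (hfB h))
  rcases r with rfl | r
  · exact hxv
  · exact ((t x y v hxyA r.1 hxvA).2 hxv).resolve_right (fun h => r.2 (hfB h))

theorem can_self {A B : Set (V × V)} (hA : IsDAG A) (hS : Skeletal A)
    (hB : ARmem A B) {u v : V} (ha : (u, v) ∈ canArcs A B) : (u, v) ∈ canJoinand A B u v :=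
  (canJoinand_iff hA hS.2 hB (hB.1 ha.1) u v).2 ⟨hB.1 ha.1, ha.1, Or.inl rfl, Or.inl rfl⟩

theorem can_antichain {A B : Set (V × V)} (hA : IsDAG A) (hS : Skeletal A)
    (hB : ARmem A B) {u v u' v' : V} (ha : (u, v) ∈ canArcs A B) (ha' : (u', v') ∈ canArcs A B)
    (h : canJoinand A B u v ⊆ canJoinand A B u' v') : (u, v) = (u', v') := by
  obtain ⟨-, -, l, r⟩ := (canJoinand_iff hA hS.2 hB (hB.1 ha'.1) u v).1 (h (can_self hA hS hB ha))
  have e : (v', u') ∈ reorient A B := mem_reorient_iff.2 (Or.inr ha'.1)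
  rcases r with rfl | r
  · rcases l with rfl | l
    · rfl
    · exact (can_no_mid ha e (mem_reorient_iff.2 (Or.inl l))).elim
  · exfalso
    refine ha.2.2 ⟨v', mem_reorient_iff.2 (Or.inl r), ?_⟩
    have e' : Relation.TransGen (ArcRel (reorient A B)) v' u' := Relation.TransGen.single e
    rcases l with rfl | l
    · exact e'
    · exact e'.tail (mem_reorient_iff.2 (Or.inl l))

end Helpers

/-- Canonical join representations in the acyclic reorientation
lattice of a skeletal directed acyclic graph. -/
theorem stmt_14 {V : Type*} [Fintype V] (A : Set (V × V)) (hA : IsDAG A)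
    (hS : Skeletal A) (B : Set (V × V)) (hB : ARmem A B) :
    (∀ a ∈ canArcs A B, ARmem A (canJoinand A B a.1 a.2)) ∧
    IsLUBofSet A ((fun a : V × V => canJoinand A B a.1 a.2) '' canArcs A B) B ∧
    (∀ T : Set (Set (V × V)),
      T ⊆ (fun a : V × V => canJoinand A B a.1 a.2) '' canArcs A B →
      T ≠ (fun a : V × V => canJoinand A B a.1 a.2) '' canArcs A B →
      ¬ IsLUBofSet A T B) ∧
    (∀ F : Set (Set (V × V)), (∀ f ∈ F, ARmem A f) → IsLUBofSet A F B →
      ∀ a ∈ canArcs A B, ∃ f ∈ F, canJoinand A B a.1 a.2 ⊆ f) := by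
  refine ⟨fun a ha => can_AR hA hS hB ha, ⟨hB, ?_, ?_⟩, ?_, ?_⟩
  · rintro s ⟨⟨u, v⟩, _, rfl⟩ b hb
    obtain ⟨_, _, _, _, _, _, h, _⟩ := hb
    exact h
  · intro w hw hs
    exact can_least hA hS hB hw (fun u v ha => hs _ ⟨(u, v), ha, rfl⟩)
  · intro T hT hne hl
    apply hne
    refine Set.Subset.antisymm hT ?_
    rintro s ⟨⟨u, v⟩, ha, rfl⟩
    have hTA : ∀ f ∈ T, ARmem A f := by
      intro f hf
      obtain ⟨⟨p, q⟩, hc, rfl⟩ := hT hf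
      exact can_AR hA hS hB hc
    obtain ⟨f, hf, hsub⟩ := can_refine hA hS hB T hTA hl ha
    obtain ⟨⟨p, q⟩, hc, rfl⟩ := hT hf
    have e := can_antichain hA hS hB ha hc hsub
    rw [e]
    exact hf
  · rintro F hF hl ⟨u, v⟩ ha
    exact can_refine hA hS hB F hF hl ha
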